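/- For every integer q ≥ 1 there exist nonzero elements c', d' of Λ₄ such that Ψ_{T'}^{2q} = c'·1 + d'·(u₂·w₃) in Q. (In the paper's language: Ψ_{T'}^{2q} lies in the Λ-span of (11 1̄1̄) and (10 0̄1̄), with both coordinates nonvanishing.) -/

import Mathlib

/- Λ₄ is the group algebra of ℝ⁴ over ℝ; `E β` is the Novikov monomial e^β,
   δ i the standard basis vectors of ℝ⁴.  `Q` is the Künneth model of the
   quantum homology of M = (S²×S²)×(S²×S²) with form (ω₀⊕λω₀)⊕(−ω₀⊕−λω₀):
   the quotient of Λ₄[U₁,U₂,U₃,U₄] by U₁²−e^{−δ₁}, U₂²−e^{−δ₂}, U₃²−e^{δ₃},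
   U₄²−e^{δ₄}; `u i` are the images of the variables (u₁,u₂,w₃,w₄). -/

noncomputable section

abbrev Λ₄ : Type := AddMonoidAlgebra ℝ (Fin 4 → ℝ)

def E (β : Fin 4 → ℝ) : Λ₄ := AddMonoidAlgebra.single β 1

def δ (i : Fin 4) : Fin 4 → ℝ := Pi.single i 1

def qRel : Ideal (MvPolynomial (Fin 4) Λ₄) :=
  Ideal.span {MvPolynomial.X 0 ^ 2 - MvPolynomial.C (E (-δ 0)),
              MvPolynomial.X 1 ^ 2 - MvPolynomial.C (E (-δ 1)),
              MvPolynomial.X 2 ^ 2 - MvPolynomial.C (E (δ 2)),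
              MvPolynomial.X 3 ^ 2 - MvPolynomial.C (E (δ 3))}

abbrev Q : Type := MvPolynomial (Fin 4) Λ₄ ⧸ qRel

def u (i : Fin 4) : Q := Ideal.Quotient.mk qRel (MvPolynomial.X i)

def eQ (β : Fin 4 → ℝ) : Q := algebraMap Λ₄ Q (E β)

/-- Ψ_S = (u₁+u₂)·e^{(1/2+h)δ₁−hδ₂} -/
def ΨS (h : ℝ) : Q := (u 0 + u 1) * eQ ((1 / 2 + h) • δ 0 - h • δ 1)

/-- Ψ_T = −(w₃+w₄)·e^{−(1/2+h)δ₃+hδ₄} -/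
def ΨT (h : ℝ) : Q := -((u 2 + u 3) * eQ (-((1 / 2 + h) • δ 2) + h • δ 3))

/-- Ψ_{S'} = (u₁−w₄)·e^{(1/2+h)δ₁+hδ₄} -/
def ΨS' (h : ℝ) : Q := (u 0 - u 3) * eQ ((1 / 2 + h) • δ 0 + h • δ 3)

/-- Ψ_{T'} = (u₂−w₃)·e^{−(1/2+h)δ₃−hδ₂} -/
def ΨT' (h : ℝ) : Q := (u 1 - u 2) * eQ (-((1 / 2 + h) • δ 2) - h • δ 1)

/-- The augmentation Λ₄ → ℝ, sending every Novikov monomial to 1. -/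
def augmentation : Λ₄ →ₐ[ℝ] ℝ := AddMonoidAlgebra.lift ℝ ℝ (Fin 4 → ℝ) 1

@[simp]
lemma augmentation_E (β : Fin 4 → ℝ) : augmentation (E β) = 1 := by
  simp [augmentation, E]

lemma u_one_sq : u 1 ^ 2 = algebraMap Λ₄ Q (E (-δ 1)) := by
  refine (Ideal.Quotient.eq (I := qRel)).2 (Ideal.subset_span ?_)
  simp

lemma u_two_sq : u 2 ^ 2 = algebraMap Λ₄ Q (E (δ 2)) := by
  refine (Ideal.Quotient.eq (I := qRel)).2 (Ideal.subset_span ?_)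
  simp

/-- The coordinates of `Ψ_{T'}^{2(n+1)}` have augmentations of opposite signs. -/
lemma exists_coords_ΨT'_pow (h : ℝ) (n : ℕ) :
    ∃ c d : Λ₄, 0 < augmentation c ∧ augmentation d < 0 ∧
      ΨT' h ^ (2 * (n + 1)) = algebraMap Λ₄ Q c + algebraMap Λ₄ Q d * (u 1 * u 2) := by
  obtain ⟨m, hm, hΨ⟩ : ∃ m : Λ₄, augmentation m = 1 ∧
      ΨT' h = (u 1 - u 2) * algebraMap Λ₄ Q m := ⟨_, augmentation_E _, rfl⟩
  have hΨ_sq : ΨT' h ^ 2 = (algebraMap Λ₄ Q (E (-δ 1)) + algebraMap Λ₄ Q (E (δ 2))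
      - 2 * (u 1 * u 2)) * algebraMap Λ₄ Q m ^ 2 := by
    rw [hΨ, ← u_one_sq, ← u_two_sq]
    ring
  induction n with
  | zero =>
    refine ⟨(E (-δ 1) + E (δ 2)) * m ^ 2, -2 * m ^ 2, ?_, ?_, ?_⟩
    · simp [hm]
    · simp [hm, map_ofNat augmentation 2]
    · simp only [zero_add, mul_one, hΨ_sq, map_add, map_mul, map_pow, map_neg, map_ofNat]
      ring
  | succ n ih =>
    obtain ⟨c, d, hc, hd, hcd⟩ := ih
    refine ⟨((E (-δ 1) + E (δ 2)) * c - 2 * (E (-δ 1) * E (δ 2)) * d) * m ^ 2,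
      ((E (-δ 1) + E (δ 2)) * d - 2 * c) * m ^ 2, ?_, ?_, ?_⟩
    · simp only [map_sub, map_add, map_mul, map_pow, map_ofNat, augmentation_E, hm]
      linarith
    · simp only [map_sub, map_add, map_mul, map_pow, map_ofNat, augmentation_E, hm]
      linarith
    · rw [mul_add_one 2 (n + 1), pow_add, hcd, hΨ_sq]
      simp only [map_sub, map_add, map_mul, map_pow, map_ofNat, ← u_one_sq, ← u_two_sq]
      ring

/-- For every q ≥ 1, Ψ_{T'}^{2q} = c'·1 + d'·(u₂·w₃) in Q with c', d' nonzero in Λ₄. -/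
theorem psiT'_even_powers_two_nonzero_coords
    (lam : ℝ) (hlam : 1 < lam) (h : ℝ) (hh : h = 1 / (6 * lam * (lam - 1)))
    (q : ℕ) (hq : 1 ≤ q) :
    ∃ c' d' : Λ₄, c' ≠ 0 ∧ d' ≠ 0 ∧
      ΨT' h ^ (2 * q) = algebraMap Λ₄ Q c' * 1 + algebraMap Λ₄ Q d' * (u 1 * u 2) := by
  obtain ⟨n, rfl⟩ := Nat.exists_eq_add_of_le' hq
  obtain ⟨c, d, hc, hd, hcd⟩ := exists_coords_ΨT'_pow h n
  refine ⟨c, d, ?_, ?_, by rw [hcd, mul_one]⟩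
  · rintro rfl
    simp at hc
  · rintro rfl
    simp at hd

end
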